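/- arXiv:1712.09023 — 3 statements merged into one kernel-verified Lean document; each statement's English description precedes it below -/
import Mathlib

section
/- Let p∈(1,∞), let ω be a Muckenhoupt A_p weight on ℝⁿ, and let 𝔉 ⊂ L^p(ω). Then 𝔉 is totally bounded in L^p(ω) provided the following three conditions hold: (1) sup_{f∈𝔉} ‖f‖_{L^p(ω)} < ∞; (2) sup_{f∈𝔉} ‖f(·+h) − f(·)‖_{L^p(ω)} → 0 as h→0; (3) sup_{f∈𝔉} ‖f − χ_{Q(0,R)} f‖_{L^p(ω)} → 0 as R→∞, where Q(0,R) is the cube centered at the origin with sidelength R. -/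
open MeasureTheory Metric Filter Set
open scoped ENNReal Topology

noncomputable section

abbrev Rn (n : ℕ) := EuclideanSpace ℝ (Fin n)

/-- θ is a modulus of continuity as in the paper: continuous, increasing,
subadditive on `[0,1]`, nonnegative, with `θ 0 = 0`. -/
def IsModulus (θ : ℝ → ℝ) : Prop :=
  ContinuousOn θ (Icc 0 1) ∧ MonotoneOn θ (Icc 0 1) ∧
    (∀ s t : ℝ, 0 ≤ s → 0 ≤ t → s + t ≤ 1 → θ (s + t) ≤ θ s + θ t) ∧
    θ 0 = 0 ∧ ∀ t ∈ Icc (0:ℝ) 1, 0 ≤ θ t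

/-- The Dini condition `∫₀¹ θ(t)/t dt < ∞`. -/
def DiniCondition (θ : ℝ → ℝ) : Prop :=
  IntegrableOn (fun t => θ t / t) (Ioc (0:ℝ) 1)

/-- `K` is a θ-type kernel with size constant `C₀`. -/
def IsThetaKernel (n : ℕ) (θ : ℝ → ℝ) (C₀ : ℝ) (K : Rn n → Rn n → ℝ) : Prop :=
  (∀ x y : Rn n, x ≠ y → |K x y| ≤ C₀ / ‖x - y‖ ^ n) ∧
    ∀ x x' y : Rn n, x ≠ y → 2 * ‖x - x'‖ ≤ ‖x - y‖ →
      |K x y - K x' y| + |K y x - K y x'| ≤ θ (‖x - x'‖ / ‖x - y‖) / ‖x - y‖ ^ n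

/-- The open cube centered at `c` with sidelength `r`. -/
def cube {n : ℕ} (c : Rn n) (r : ℝ) : Set (Rn n) := {x | ∀ i, |x i - c i| < r / 2}

/-- `ω` is a Muckenhoupt `A_p` weight (over cubes). -/
def IsAp (n : ℕ) (p : ℝ) (ω : Rn n → ℝ) : Prop :=
  (∀ᵐ x : Rn n, 0 < ω x) ∧ LocallyIntegrable ω volume ∧
    ∃ A : ℝ≥0∞, A ≠ ⊤ ∧ ∀ (c : Rn n) (r : ℝ), 0 < r →
      ((∫⁻ x in cube c r, ENNReal.ofReal (ω x)) / ENNReal.ofReal (r ^ n)) *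
        (((∫⁻ x in cube c r, ENNReal.ofReal (ω x ^ (1 - p / (p - 1)))) /
          ENNReal.ofReal (r ^ n)) ^ (p - 1)) ≤ A

/-- The measure `ω(x) dx`. -/
def wMeasure (n : ℕ) (ω : Rn n → ℝ) : Measure (Rn n) :=
  (volume : Measure (Rn n)).withDensity fun x => ENNReal.ofReal (ω x)

/-- Hardy–Littlewood maximal function, `ℝ≥0∞`-valued. -/
def maximal {n : ℕ} (f : Rn n → ℝ) (x : Rn n) : ℝ≥0∞ :=
  ⨆ (r : ℝ) (_ : 0 < r),
    (volume (ball x r))⁻¹ * ∫⁻ y in ball x r, ENNReal.ofReal |f y|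

/-- Mean oscillation of `b` over the ball `B(c,r)`. -/
def oscBall {n : ℕ} (b : Rn n → ℝ) (c : Rn n) (r : ℝ) : ℝ :=
  ⨍ x in ball c r, |b x - ⨍ y in ball c r, b y|

/-- `b ∈ BMO(ℝⁿ)`. -/
def IsBMO {n : ℕ} (b : Rn n → ℝ) : Prop :=
  LocallyIntegrable b volume ∧ ∃ C : ℝ, ∀ c r, 0 < r → oscBall b c r ≤ C

/-- The BMO norm of `b`. -/
def bmoNorm {n : ℕ} (b : Rn n → ℝ) : ℝ :=
  ⨆ c : Rn n, ⨆ r : {r : ℝ // 0 < r}, oscBall b c r.1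

/-- `b ∈ VMO(ℝⁿ)`: `b ∈ BMO` and its oscillation over balls of a fixed size tends to `0`
both as the size tends to `0` and as it tends to `∞`. -/
def IsVMO {n : ℕ} (b : Rn n → ℝ) : Prop :=
  IsBMO b ∧
    Tendsto (fun r : ℝ => ⨆ c : Rn n, oscBall b c r) (𝓝[>] 0) (𝓝 0) ∧
    Tendsto (fun r : ℝ => ⨆ c : Rn n, oscBall b c r) atTop (𝓝 0)

/-- `T` is an operator, bounded on `L²`, associated with the kernel `K`:
for smooth compactly supported `f` and a.e. `x` outside the support of `f`,
`T f x = ∫ K x y * f y dy`. -/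
def IsCZO (n : ℕ) (K : Rn n → Rn n → ℝ)
    (T : Lp ℝ 2 (volume : Measure (Rn n)) →L[ℝ] Lp ℝ 2 (volume : Measure (Rn n))) : Prop :=
  ∀ (f : Rn n → ℝ) (hf : MemLp f 2 (volume : Measure (Rn n))),
    ContDiff ℝ (⊤ : ℕ∞) f → HasCompactSupport f →
      ∀ᵐ x : Rn n, x ∉ tsupport f → (T (hf.toLp f) : Rn n → ℝ) x = ∫ y, K x y * f y

/-- Properties of the smooth truncation function `ψ`. -/
def PsiCond (ψ : ℝ → ℝ) (C₁ : ℝ) : Prop :=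
  (∀ t, 0 ≤ ψ t ∧ ψ t ≤ 1) ∧ (∀ t ≤ (1:ℝ)/2, ψ t = 0) ∧ (∀ t, 1 ≤ t → ψ t = 1) ∧
    ∀ t ∈ Ioo ((1:ℝ)/2) 1, |deriv ψ t| ≤ C₁

/-- The maximal commutator `[b,T*] f (x)`. -/
def maxComm {n : ℕ} (K : Rn n → Rn n → ℝ) (b f : Rn n → ℝ) (x : Rn n) : ℝ≥0∞ :=
  ⨆ (ε : ℝ) (_ : 0 < ε),
    ENNReal.ofReal |∫ y in {y : Rn n | ε ≤ dist x y}, (b x - b y) * K x y * f y|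

/-- The maximal truncated singular integral `T* f (x)`. -/
def truncT {n : ℕ} (K : Rn n → Rn n → ℝ) (f : Rn n → ℝ) (x : Rn n) : ℝ≥0∞ :=
  ⨆ (ε : ℝ) (_ : 0 < ε),
    ENNReal.ofReal |∫ y in {y : Rn n | ε ≤ dist x y}, K x y * f y|

/-- Weighted `L^p` "norm" of an `ℝ≥0∞`-valued function. -/
def wLpNorm {n : ℕ} (p : ℝ) (μ : Measure (Rn n)) (g : Rn n → ℝ≥0∞) : ℝ≥0∞ :=
  (∫⁻ x, g x ^ p ∂μ) ^ (1 / p)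

/-- `‖∇b‖_∞`. -/
def gradSup {n : ℕ} (b : Rn n → ℝ) : ℝ := ⨆ x : Rn n, ‖fderiv ℝ b x‖

/-- The maximal operator `M_b`. -/
def Mb {n : ℕ} (b f : Rn n → ℝ) (x : Rn n) : ℝ≥0∞ :=
  ⨆ (r : ℝ) (_ : 0 < r),
    (ENNReal.ofReal (r ^ n))⁻¹ * ∫⁻ y in ball x r, ENNReal.ofReal (|b x - b y| * |f y|)

def hcube (n : ℕ) (a b : ℝ) : Set (Rn n) := WithLp.ofLp ⁻¹' (Set.pi univ fun _ => Ico a b)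

lemma hcube_meas (n : ℕ) (a b : ℝ) : MeasurableSet (hcube n a b) :=
  (PiLp.volume_preserving_ofLp (Fin n)).measurable
    (MeasurableSet.univ_pi fun _ => measurableSet_Ico)

lemma hcube_vol (n : ℕ) (a b : ℝ) : volume (hcube n a b) = ENNReal.ofReal (b - a) ^ n := by
  rw [hcube, (PiLp.volume_preserving_ofLp (Fin n)).measure_preimage
    (MeasurableSet.univ_pi fun _ => measurableSet_Ico).nullMeasurableSet, Real.volume_pi_Ico]
  simp

def flo {n : ℕ} (δ : ℝ) (x : Rn n) : Rn n := WithLp.toLp 2 fun i => δ * (⌊x i / δ⌋ : ℝ)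

lemma flo_meas {n : ℕ} (δ : ℝ) : Measurable (flo (n := n) δ) := by
  unfold flo
  apply (WithLp.measurable_toLp 2 _).comp
  refine measurable_pi_lambda _ fun i => ?_
  have : Measurable fun x : Rn n => x i := by fun_prop
  have h2 : Measurable fun x : Rn n => ⌊x i / δ⌋ := Int.measurable_floor.comp (this.div_const δ)
  exact (measurable_from_top.comp h2).const_mul δ

lemma exists_t {n : ℕ} (μ : Measure (Rn n)) [SFinite μ] (f : Rn n → ℝ) (hf : Measurable f)
    (p δ : ℝ) (hδ : 0 < δ) (a : ℝ≥0∞) (ha : a ≠ ⊤)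
    (H : ∀ h ∈ hcube n (-δ) δ, ∫⁻ x, ‖f (x + h) - f x‖ₑ ^ p ∂μ ≤ a) :
    ∃ t, ∫⁻ x, ‖f x - f (flo δ x + t)‖ₑ ^ p ∂μ ≤ 2 ^ n * a := by
  set T := hcube n 0 δ
  set S := hcube n (-δ) δ
  have hTm : MeasurableSet T := hcube_meas _ _ _
  have hSm : MeasurableSet S := hcube_meas _ _ _
  have hT : volume T = ENNReal.ofReal δ ^ n := by simp [T, hcube_vol]
  have hS : volume S = 2 ^ n * volume T := by
    rw [hT]; simp only [S, hcube_vol]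
    rw [← mul_pow, ← ENNReal.ofReal_ofNat, ← ENNReal.ofReal_mul (by norm_num)]
    congr 2; ring
  have hT0 : volume T ≠ 0 := by rw [hT]; simp [hδ]
  have hTt : volume T ≠ ⊤ := by rw [hT]; simp
  have flm := flo_meas (n := n) δ
  have key : ∫⁻ t in T, ∫⁻ x, ‖f x - f (flo δ x + t)‖ₑ ^ p ∂μ ≤ volume S * a := by
    calc ∫⁻ t in T, ∫⁻ x, ‖f x - f (flo δ x + t)‖ₑ ^ p ∂μ
        = ∫⁻ x, (∫⁻ t in T, ‖f x - f (flo δ x + t)‖ₑ ^ p) ∂μ := by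
          rw [lintegral_lintegral_swap]
          apply Measurable.aemeasurable
          simp only [Function.uncurry_def]
          fun_prop
      _ ≤ ∫⁻ x, (∫⁻ h in S, ‖f (x + h) - f x‖ₑ ^ p) ∂μ := by
          refine lintegral_mono fun x => ?_
          rw [← lintegral_indicator hTm, ← lintegral_indicator hSm]
          rw [(lintegral_add_left_eq_self
            (T.indicator fun t => ‖f x - f (flo δ x + t)‖ₑ ^ p) (x - flo δ x)).symm]
          refine lintegral_mono fun h => ?_
          by_cases hT' : x - flo δ x + h ∈ T
          · have hS' : h ∈ S := by
              intro i _
              have h1 := hT' i (mem_univ i)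
              simp only [flo, PiLp.add_apply, PiLp.sub_apply, mem_Ico] at h1 ⊢
              have h2 : δ * (⌊x i / δ⌋ : ℝ) ≤ x i := by
                have := Int.floor_le (x i / δ)
                rw [le_div_iff₀ hδ] at this
                linarith
              have h3 : x i < δ * (⌊x i / δ⌋ : ℝ) + δ := by
                have := Int.lt_floor_add_one (x i / δ)
                rw [div_lt_iff₀ hδ] at this
                linarith
              constructor <;> linarith
            rw [indicator_of_mem hT', indicator_of_mem hS', ← enorm_neg]
            apply le_of_eq
            congr 2
            rw [show flo δ x + (x - flo δ x + h) = x + h by abel]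
            ring
          · rw [indicator_of_notMem hT']
            exact zero_le
      _ = ∫⁻ h in S, (∫⁻ x, ‖f (x + h) - f x‖ₑ ^ p ∂μ) := by
          rw [lintegral_lintegral_swap]
          apply Measurable.aemeasurable
          simp only [Function.uncurry_def]
          fun_prop
      _ ≤ ∫⁻ h in S, a := setLIntegral_mono measurable_const H
      _ = volume S * a := by simp [mul_comm]
  have hfin : volume S * a ≠ ⊤ := by
    rw [hS]; exact ENNReal.mul_ne_top (ENNReal.mul_ne_top (by simp) hTt) ha
  obtain ⟨t, -, ht⟩ := exists_le_setLAverage hT0 hTt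
    (f := fun t => ∫⁻ x, ‖f x - f (flo δ x + t)‖ₑ ^ p ∂μ) (by
      apply Measurable.aemeasurable
      apply Measurable.lintegral_prod_left'
        (f := fun z : Rn n × Rn n => ‖f z.1 - f (flo δ z.1 + z.2)‖ₑ ^ p)
      fun_prop)
  refine ⟨t, ht.trans ?_⟩
  rw [setLAverage_eq]
  refine ENNReal.div_le_of_le_mul (key.trans (le_of_eq ?_))
  rw [hS]; ring

lemma tb_of_findim {E : Type*} [NormedAddCommGroup E] [NormedSpace ℝ E] (F : Set E)
    (h1 : ∃ M : ℝ, ∀ f ∈ F, ‖f‖ ≤ M)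
    (h : ∀ ε > 0, ∃ V : Submodule ℝ E, FiniteDimensional ℝ V ∧ ∀ f ∈ F, ∃ g ∈ V, ‖f - g‖ < ε) :
    TotallyBounded F := by
  obtain ⟨M, hM⟩ := h1
  rw [Metric.totallyBounded_iff]
  intro ε hε
  obtain ⟨V, hV, hV2⟩ := h (ε / 2) (by linarith)
  have hc : IsCompact (V.subtypeL '' closedBall (0 : V) (M + ε / 2)) :=
    (isCompact_closedBall _ _).image V.subtypeL.continuous
  obtain ⟨t, ht, ht2⟩ := Metric.totallyBounded_iff.1 hc.totallyBounded (ε / 2) (by linarith)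
  refine ⟨t, ht, fun f hf => ?_⟩
  obtain ⟨g, hg, hfg⟩ := hV2 f hf
  have : g ∈ V.subtypeL '' closedBall (0 : V) (M + ε / 2) := by
    refine ⟨⟨g, hg⟩, ?_, rfl⟩
    rw [mem_closedBall_zero_iff]
    have h3 := norm_sub_le f (f - g)
    have h4 := hM f hf
    simp only [sub_sub_cancel] at h3
    simp only [Submodule.coe_norm]
    linarith
  have := ht2 this
  simp only [mem_iUnion, mem_ball, exists_prop] at this ⊢
  obtain ⟨y, hy, hgy⟩ := this
  refine ⟨y, hy, ?_⟩
  have := dist_triangle f g y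
  rw [dist_eq_norm f g] at this
  linarith

lemma cube_meas {n : ℕ} (R : ℝ) : MeasurableSet (cube (0 : Rn n) R) := by
  unfold cube
  simp only [ofPred_forall]
  refine MeasurableSet.iInter fun i => ?_
  have : Measurable fun x : Rn n => |x i - (0 : Rn n) i| := by fun_prop
  exact measurableSet_lt this measurable_const

lemma cube_fin {n : ℕ} (ω : Rn n → ℝ) (hω : LocallyIntegrable ω volume) (R : ℝ) :
    wMeasure n ω (cube (0 : Rn n) R) < ⊤ := by
  have hc : IsCompact (WithLp.toLp 2 '' (closedBall (0 : Fin n → ℝ) |R / 2|) : Set (Rn n)) :=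
    (isCompact_closedBall _ _).image (PiLp.continuous_toLp 2 _)
  have hsub : cube (0 : Rn n) R ⊆ WithLp.toLp 2 '' (closedBall (0 : Fin n → ℝ) |R / 2|) := by
    intro x hx
    refine ⟨WithLp.ofLp x, ?_, rfl⟩
    rw [mem_closedBall_zero_iff, pi_norm_le_iff_of_nonneg (abs_nonneg _)]
    intro i
    have := hx i
    simp only [PiLp.zero_apply, sub_zero] at this
    exact this.le.trans (le_abs_self _)
  refine (measure_mono hsub).trans_lt ?_
  rw [wMeasure, withDensity_apply']
  exact Integrable.lintegral_lt_top (hω.integrableOn_isCompact hc)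

def cell {n : ℕ} (δ R : ℝ) (k : Fin n → ℤ) : Set (Rn n) :=
  cube (0 : Rn n) R ∩ {x | ∀ i, ⌊x i / δ⌋ = k i}

lemma cell_meas {n : ℕ} (δ R : ℝ) (k : Fin n → ℤ) : MeasurableSet (cell δ R k) := by
  refine (cube_meas R).inter ?_
  simp only [ofPred_forall]
  refine MeasurableSet.iInter fun i => ?_
  have : Measurable fun x : Rn n => x i := by fun_prop
  have h2 : Measurable fun x : Rn n => ⌊x i / δ⌋ := Int.measurable_floor.comp (this.div_const δ)
  exact h2 (measurableSet_singleton (k i))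

def KK (n : ℕ) (δ R : ℝ) : Finset (Fin n → ℤ) :=
  Fintype.piFinset fun _ => Finset.Icc (-⌈R / 2 / δ⌉) ⌈R / 2 / δ⌉

lemma sum_cell {n : ℕ} (δ R : ℝ) (hδ : 0 < δ) (f : Rn n → ℝ) (t x : Rn n) :
    (cube (0 : Rn n) R).indicator (fun x => f (flo δ x + t)) x =
      ∑ k ∈ KK n δ R, f (WithLp.toLp 2 (fun i => δ * (k i : ℝ)) + t) *
        (cell δ R k).indicator (fun _ => (1 : ℝ)) x := by
  by_cases hx : x ∈ cube (0 : Rn n) R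
  · rw [indicator_of_mem hx, Finset.sum_eq_single (fun i => ⌊x i / δ⌋)]
    · have hm : x ∈ cell δ R (fun i => ⌊x i / δ⌋) := ⟨hx, fun i => rfl⟩
      rw [indicator_of_mem hm, mul_one]; rfl
    · intro k _ hk
      rw [indicator_of_notMem, mul_zero]
      rintro ⟨_, h⟩
      exact hk (funext fun i => (h i).symm)
    · intro h
      exfalso; apply h
      simp only [KK, Fintype.mem_piFinset, Finset.mem_Icc]
      intro i
      have h1 := hx i
      simp only [PiLp.zero_apply, sub_zero, abs_lt] at h1
      have h2 := Int.le_ceil (R / 2 / δ)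
      have h3 : x i / δ ≤ R / 2 / δ := by gcongr; exact h1.2.le
      have h4 : -(R / 2 / δ) ≤ x i / δ := by
        rw [← neg_div]; gcongr; exact h1.1.le
      constructor
      · rw [Int.le_floor]; push_cast; linarith
      · have h5 := Int.floor_le (x i / δ)
        exact Int.cast_le (R := ℝ).1 (h5.trans (h3.trans h2))
  · rw [indicator_of_notMem hx, Finset.sum_eq_zero]
    intro k _
    rw [indicator_of_notMem (fun h => hx h.1), mul_zero]

lemma eLp_le {n : ℕ} (μ : Measure (Rn n)) (p : ℝ) (hp : 1 < p) (g : Rn n → ℝ) (η : ℝ≥0∞)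
    (h : ∫⁻ x, ‖g x‖ₑ ^ p ∂μ ≤ 2 ^ n * η ^ p) : eLpNorm g (ENNReal.ofReal p) μ ≤ 2 ^ n * η := by
  have hp0 : 0 < p := by linarith
  rw [eLpNorm_eq_lintegral_rpow_enorm_toReal (by simpa using hp0) (by simp),
    ENNReal.toReal_ofReal hp0.le, one_div, ENNReal.rpow_inv_le_iff hp0,
    ENNReal.mul_rpow_of_nonneg _ _ hp0.le]
  refine h.trans ?_
  gcongr
  conv_lhs => rw [← ENNReal.rpow_one (2 ^ n)]
  exact ENNReal.rpow_le_rpow_of_exponent_le (one_le_pow₀ (by norm_num)) hp.le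

lemma le_eLp {n : ℕ} (μ : Measure (Rn n)) (p : ℝ) (hp : 1 < p) (g : Rn n → ℝ) (η : ℝ≥0∞)
    (h : eLpNorm g (ENNReal.ofReal p) μ ≤ η) : ∫⁻ x, ‖g x‖ₑ ^ p ∂μ ≤ η ^ p := by
  have hp0 : 0 < p := by linarith
  rwa [eLpNorm_eq_lintegral_rpow_enorm_toReal (by simpa using hp0) (by simp),
    ENNReal.toReal_ofReal hp0.le, one_div, ENNReal.rpow_inv_le_iff hp0] at h

lemma coe_sum {n : ℕ} {μ : Measure (Rn n)} {q : ℝ≥0∞} {ι : Type*} (s : Finset ι)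
    (c : ι → ℝ) (A : ι → Set (Rn n)) (hA : ∀ k, MeasurableSet (A k)) (hA' : ∀ k, μ (A k) ≠ ⊤) :
    ((∑ k ∈ s, c k • indicatorConstLp q (hA k) (hA' k) (1 : ℝ) : Lp ℝ q μ) : Rn n → ℝ) =ᵐ[μ]
      fun x => ∑ k ∈ s, c k * (A k).indicator (fun _ => (1 : ℝ)) x := by
  classical
  induction s using Finset.induction_on with
  | empty => simp only [Finset.sum_empty]; exact Lp.coeFn_zero ℝ q μ
  | insert a s ha ih =>
    rw [Finset.sum_insert ha]
    filter_upwards [ih, Lp.coeFn_add (c a • indicatorConstLp q (hA a) (hA' a) (1 : ℝ))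
      (∑ k ∈ s, c k • indicatorConstLp q (hA k) (hA' k) (1 : ℝ) : Lp ℝ q μ),
      Lp.coeFn_smul (c a) (indicatorConstLp q (hA a) (hA' a) (1 : ℝ)),
      indicatorConstLp_coeFn (p := q) (hs := hA a) (hμs := hA' a) (c := (1 : ℝ))] with x h1 h2 h3 h4
    rw [h2, Pi.add_apply, h1, h3, Pi.smul_apply, h4, Finset.sum_insert ha, smul_eq_mul]

theorem fk_main {n : ℕ} (p : ℝ) (hp : 1 < p) [Fact (1 ≤ ENNReal.ofReal p)]
    (ω : Rn n → ℝ) (hω : LocallyIntegrable ω volume)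
    (F : Set (Lp ℝ (ENNReal.ofReal p) (wMeasure n ω)))
    (h1 : ∃ M : ℝ, ∀ f ∈ F, ‖f‖ ≤ M)
    (h2 : Tendsto (fun h : Rn n => ⨆ f ∈ F,
        eLpNorm (fun x => (f : Rn n → ℝ) (x + h) - (f : Rn n → ℝ) x)
          (ENNReal.ofReal p) (wMeasure n ω)) (𝓝 0) (𝓝 0))
    (h3 : Tendsto (fun R : ℝ => ⨆ f ∈ F,
        eLpNorm (fun x => (f : Rn n → ℝ) x - (cube (0 : Rn n) R).indicator f x)
          (ENNReal.ofReal p) (wMeasure n ω)) atTop (𝓝 0)) :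
    TotallyBounded F := by
  have : SFinite (wMeasure n ω) := by unfold wMeasure; infer_instance
  refine tb_of_findim F h1 fun ε hε => ?_
  set η : ℝ≥0∞ := ENNReal.ofReal (ε / 3 / 2 ^ n) with hη
  have hη0 : 0 < η := by rw [hη, ENNReal.ofReal_pos]; positivity
  have hηt : η ≠ ⊤ := ENNReal.ofReal_ne_top
  have hη2 : 2 ^ n * η = ENNReal.ofReal (ε / 3) := by
    rw [hη, show (2 : ℝ≥0∞) ^ n = ENNReal.ofReal (2 ^ n) by
      rw [ENNReal.ofReal_pow (by norm_num)]; simp, ← ENNReal.ofReal_mul (by positivity)]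
    congr 1; field_simp
  obtain ⟨R, hR⟩ := (h3.eventually_le_const
    (show (0 : ℝ≥0∞) < ENNReal.ofReal (ε / 3) by rw [ENNReal.ofReal_pos]; positivity)).exists
  have hh := h2.eventually_le_const hη0
  have hc : Tendsto (WithLp.toLp 2 : (Fin n → ℝ) → Rn n) (𝓝 0) (𝓝 0) :=
    (PiLp.continuous_toLp 2 (fun _ : Fin n => ℝ)).tendsto' 0 0 rfl
  obtain ⟨δ₀, hδ₀, hball⟩ := Metric.eventually_nhds_iff.1 (hc.eventually hh)
  set δ := δ₀ / 2 with hδd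
  have hδ : 0 < δ := by positivity
  have hfin : ∀ k, wMeasure n ω (cell δ R k) ≠ ⊤ := fun k =>
    ((measure_mono inter_subset_left).trans_lt (cube_fin ω hω R)).ne
  set e : (Fin n → ℤ) → Lp ℝ (ENNReal.ofReal p) (wMeasure n ω) := fun k =>
    indicatorConstLp (ENNReal.ofReal p) (cell_meas δ R k) (hfin k) (1 : ℝ) with he
  refine ⟨Submodule.span ℝ (e '' (KK n δ R : Set (Fin n → ℤ))),
    FiniteDimensional.span_of_finite ℝ ((KK n δ R).finite_toSet.image e), fun f hf => ?_⟩
  obtain ⟨t, ht⟩ := exists_t (wMeasure n ω) f (Lp.stronglyMeasurable f).measurable p δ hδ (η ^ p)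
    (ENNReal.rpow_ne_top_of_nonneg (by linarith) hηt) (by
      intro h hh'
      apply le_eLp _ _ hp (fun x => f (x + h) - f x)
      have : dist (WithLp.ofLp h) 0 < δ₀ := by
        rw [dist_zero_right, pi_norm_lt_iff hδ₀]
        intro i
        have := hh' i (mem_univ i)
        simp only [mem_Ico] at this
        rw [Real.norm_eq_abs, abs_lt]
        constructor <;> linarith
      have := hball this
      exact (le_iSup₂ (f := fun (f : Lp ℝ (ENNReal.ofReal p) (wMeasure n ω)) (_ : f ∈ F) =>
        eLpNorm (fun x => f (x + h) - f x) (ENNReal.ofReal p) (wMeasure n ω)) f hf).trans this)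
  have ht2 := eLp_le _ _ hp (fun x => f x - f (flo δ x + t)) _ ht
  rw [hη2] at ht2
  have hR2 := (le_iSup₂ (f := fun (f : Lp ℝ (ENNReal.ofReal p) (wMeasure n ω)) (_ : f ∈ F) =>
    eLpNorm (fun x => (f : Rn n → ℝ) x - (cube (0 : Rn n) R).indicator f x)
          (ENNReal.ofReal p) (wMeasure n ω)) f hf).trans hR
  refine ⟨∑ k ∈ KK n δ R, f (WithLp.toLp 2 (fun i => δ * (k i : ℝ)) + t) • e k,
    Submodule.sum_mem _ fun k hk => Submodule.smul_mem _ _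
      (Submodule.subset_span ⟨k, hk, rfl⟩), ?_⟩
  have hfm : Measurable f := (Lp.stronglyMeasurable f).measurable
  have flm := flo_meas (n := n) δ
  have hae := coe_sum (q := ENNReal.ofReal p) (KK n δ R)
    (fun k => f (WithLp.toLp 2 (fun i => δ * (k i : ℝ)) + t)) (cell δ R) (cell_meas δ R) hfin
  rw [Lp.norm_def]
  refine (ENNReal.toReal_le_of_le_ofReal (b := ε / 3 + ε / 3) (by positivity) ?_).trans_lt
    (by linarith)
  rw [ENNReal.ofReal_add (by positivity) (by positivity)]
  refine le_trans (le_of_eq ?_) ((eLpNorm_add_le (μ := wMeasure n ω) (p := ENNReal.ofReal p)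
    (f := fun x => (f : Rn n → ℝ) x - (cube (0 : Rn n) R).indicator f x)
    (g := (cube (0 : Rn n) R).indicator fun x => f x - f (flo δ x + t)) ?_ ?_ Fact.out).trans
    (add_le_add hR2 ((eLpNorm_indicator_le _).trans ht2)))
  · apply eLpNorm_congr_ae
    filter_upwards [hae, Lp.coeFn_sub f
      (∑ k ∈ KK n δ R, f (WithLp.toLp 2 (fun i => δ * (k i : ℝ)) + t) • e k)] with x h1 h2
    rw [h2, Pi.sub_apply, h1, ← sum_cell δ R hδ f t x, Pi.add_apply]
    by_cases hx : x ∈ cube (0 : Rn n) R <;> simp [hx]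
  · exact (hfm.sub (hfm.indicator (cube_meas R))).aestronglyMeasurable
  · refine Measurable.aestronglyMeasurable (Measurable.indicator ?_ (cube_meas R))
    fun_prop

/-- weighted Fréchet–Kolmogorov. Let `1 < p < ∞`, `ω ∈ A_p`, and let
`F ⊆ L^p(ω)`. If `F` is uniformly bounded, uniformly `L^p(ω)`-equicontinuous, and uniformly
vanishes at infinity (w.r.t. cubes `Q(0,R)`), then `F` is totally bounded in `L^p(ω)`. -/
theorem statement2 {n : ℕ} (p : ℝ) (hp : 1 < p) [Fact (1 ≤ ENNReal.ofReal p)]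
    (ω : Rn n → ℝ) (hω : IsAp n p ω)
    (F : Set (Lp ℝ (ENNReal.ofReal p) (wMeasure n ω)))
    (h1 : ∃ M : ℝ, ∀ f ∈ F, ‖f‖ ≤ M)
    (h2 : Tendsto (fun h : Rn n => ⨆ f ∈ F,
        eLpNorm (fun x => (f : Rn n → ℝ) (x + h) - (f : Rn n → ℝ) x)
          (ENNReal.ofReal p) (wMeasure n ω)) (𝓝 0) (𝓝 0))
    (h3 : Tendsto (fun R : ℝ => ⨆ f ∈ F,
        eLpNorm (fun x => (f : Rn n → ℝ) x - (cube (0 : Rn n) R).indicator f x)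
          (ENNReal.ofReal p) (wMeasure n ω)) atTop (𝓝 0)) :
    TotallyBounded F := by
  exact fk_main p hp ω hω.2.1 F h1 h2 h3
end
end

section
/- Let 1<p<∞, ω a Muckenhoupt A_p weight on ℝⁿ, K a θ-type kernel, b ∈ C_c^∞(ℝⁿ), and fix η>0. Then the family {[b,T^η]f : ‖f‖_{L^p(ω)} ≤ 1} uniformly vanishes at infinity: lim_{R→∞} sup_{‖f‖_{L^p(ω)}≤1} (∫_{|x|>R} |[b,T^η]f(x)|^p ω(x) dx)^{1/p} = 0. -/
open MeasureTheory Metric Filter Set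
open scoped ENNReal Topology

noncomputable section

def wt {n : ℕ} (ω : Rn n → ℝ) (x : Rn n) : ℝ≥0∞ := ENNReal.ofReal (ω x)
def st {n : ℕ} (p : ℝ) (ω : Rn n → ℝ) (x : Rn n) : ℝ≥0∞ :=
  ENNReal.ofReal (ω x ^ (1 - p / (p - 1)))

lemma cube_eq {n : ℕ} (c : Rn n) (r : ℝ) :
    cube c r = WithLp.ofLp ⁻¹' (Set.univ.pi fun i => Ioo (c i - r / 2) (c i + r / 2)) := by
  ext x
  simp only [cube, mem_setOf_eq, mem_preimage, Set.mem_pi, mem_univ, true_imp_iff, mem_Ioo]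
  refine forall_congr' fun i => ?_
  rw [abs_lt]
  constructor <;> rintro ⟨h1, h2⟩ <;> constructor <;> linarith

lemma measurableSet_cube {n : ℕ} (c : Rn n) (r : ℝ) : MeasurableSet (cube c r) := by
  rw [cube_eq]
  exact (PiLp.volume_preserving_ofLp (Fin n)).measurable
    (MeasurableSet.univ_pi fun i => measurableSet_Ioo)

lemma volume_cube {n : ℕ} (c : Rn n) (r : ℝ) (hr : 0 < r) :
    volume (cube c r) = ENNReal.ofReal (r ^ n) := by
  rw [cube_eq, (PiLp.volume_preserving_ofLp (Fin n)).measure_preimage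
    (MeasurableSet.univ_pi fun i => measurableSet_Ioo).nullMeasurableSet, Real.volume_pi_Ioo]
  have : ∀ i : Fin n, ENNReal.ofReal (c i + r / 2 - (c i - r / 2)) = ENNReal.ofReal r := by
    intro i; congr 1; ring
  simp only [this, Finset.prod_const, Finset.card_univ, Fintype.card_fin]
  rw [ENNReal.ofReal_pow hr.le]

lemma wt_aem {n : ℕ} {p : ℝ} {ω : Rn n → ℝ} (hω : IsAp n p ω) :
    AEMeasurable (wt ω) (volume : Measure (Rn n)) :=
  hω.2.1.aestronglyMeasurable.aemeasurable.ennreal_ofReal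

lemma holder {n : ℕ} {p : ℝ} (hp : 1 < p) {ω : Rn n → ℝ} (hω : IsAp n p ω)
    (g : Rn n → ℝ≥0∞) (hg : AEMeasurable g (volume : Measure (Rn n))) (B : Set (Rn n)) :
    (∫⁻ x in B, g x) ^ p ≤ (∫⁻ x in B, g x ^ p * wt ω x) * (∫⁻ x in B, st p ω x) ^ (p - 1) := by
  have hp0 : 0 < p := by linarith
  have hp1 : 0 < p - 1 := by linarith
  have hpq : p.HolderConjugate (p / (p - 1)) := Real.HolderConjugate.conjExponent hp
  have hm := wt_aem hω
  have h := ENNReal.lintegral_mul_le_Lp_mul_Lq ((volume : Measure (Rn n)).restrict B) hpq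
    (f := fun x => g x * wt ω x ^ (1 / p)) (g := fun x => wt ω x ^ (-(1 / p)))
    (hg.mul (hm.pow_const _)).restrict (hm.pow_const _).restrict
  have e1 : ∫⁻ x in B, ((fun x => g x * wt ω x ^ (1 / p)) * (fun x => wt ω x ^ (-(1 / p)))) x
      = ∫⁻ x in B, g x := by
    apply lintegral_congr_ae
    apply ae_restrict_of_ae
    filter_upwards [hω.1] with x hx
    have h0 : wt ω x ≠ 0 := by simpa [wt] using hx
    have ht : wt ω x ≠ ⊤ := by simp [wt]
    simp only [Pi.mul_apply]
    rw [mul_assoc, ← ENNReal.rpow_add _ _ h0 ht]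
    simp
  have e2 : ∫⁻ x in B, (g x * wt ω x ^ (1 / p)) ^ p = ∫⁻ x in B, g x ^ p * wt ω x := by
    congr 1; ext x
    rw [ENNReal.mul_rpow_of_nonneg _ _ hp0.le, ← ENNReal.rpow_mul, one_div_mul_cancel hp0.ne',
      ENNReal.rpow_one]
  have e3 : ∫⁻ x in B, (wt ω x ^ (-(1 / p))) ^ (p / (p - 1)) = ∫⁻ x in B, st p ω x := by
    apply lintegral_congr_ae
    apply ae_restrict_of_ae
    filter_upwards [hω.1] with x hx
    simp only [wt, st]
    rw [← ENNReal.rpow_mul, ENNReal.ofReal_rpow_of_pos hx]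
    congr 2
    field_simp
    ring
  rw [e1, e2, e3] at h
  have h' := ENNReal.rpow_le_rpow h hp0.le
  rw [ENNReal.mul_rpow_of_nonneg _ _ hp0.le, ← ENNReal.rpow_mul, ← ENNReal.rpow_mul,
    one_div_mul_cancel hp0.ne', ENNReal.rpow_one] at h'
  convert h' using 3
  field_simp

lemma ap_bound {n : ℕ} {p : ℝ} (hp : 1 < p) {ω : Rn n → ℝ} (hω : IsAp n p ω) :
    ∃ A : ℝ≥0∞, A ≠ ⊤ ∧ A ≠ 0 ∧ ∀ (c : Rn n) (r : ℝ), 0 < r →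
      (∫⁻ x in cube c r, wt ω x) * (∫⁻ x in cube c r, st p ω x) ^ (p - 1) ≤
        A * ENNReal.ofReal (r ^ n) ^ p := by
  obtain ⟨A, hA, h⟩ := hω.2.2
  refine ⟨A + 1, by simp [hA], by simp, fun c r hr => ?_⟩
  have hp1 : 0 < p - 1 := by linarith
  have h1 := h c r hr
  have t0 : ENNReal.ofReal (r ^ n) ≠ 0 := by simp; positivity
  have tt : ENNReal.ofReal (r ^ n) ≠ ⊤ := by simp
  change ((∫⁻ x in cube c r, wt ω x) / _) * ((∫⁻ x in cube c r, st p ω x) / _) ^ (p - 1) ≤ A at h1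
  generalize ENNReal.ofReal (r ^ n) = t at *
  generalize (∫⁻ x in cube c r, wt ω x) = W at *
  generalize (∫⁻ x in cube c r, st p ω x) = V at *
  have e : W * V ^ (p - 1) = (W / t) * (V / t) ^ (p - 1) * t ^ p := by
    have e1 : t ^ p = t * t ^ (p - 1) := by
      conv_rhs => enter [1]; rw [← ENNReal.rpow_one t]
      rw [← ENNReal.rpow_add _ _ t0 tt]; congr 1; ring
    calc W * V ^ (p - 1) = (W / t * t) * (V / t * t) ^ (p - 1) := by
          rw [ENNReal.div_mul_cancel t0 tt, ENNReal.div_mul_cancel t0 tt]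
      _ = _ := by rw [ENNReal.mul_rpow_of_nonneg _ _ hp1.le, e1]; ring
  rw [e]
  gcongr
  exact h1.trans (by simp)

lemma ap_low {n : ℕ} {p : ℝ} (hp : 1 < p) {ω : Rn n → ℝ} (hω : IsAp n p ω) (c : Rn n) (r : ℝ)
    (hr : 0 < r) : ENNReal.ofReal (r ^ n) ^ p ≤
      (∫⁻ x in cube c r, wt ω x) * (∫⁻ x in cube c r, st p ω x) ^ (p - 1) := by
  have := holder hp hω (fun _ => 1) aemeasurable_const (cube c r)
  simpa [volume_cube c r hr] using this

lemma st_fin {n : ℕ} {p : ℝ} (hp : 1 < p) {ω : Rn n → ℝ} (hω : IsAp n p ω) (c : Rn n) (r : ℝ)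
    (hr : 0 < r) : (∫⁻ x in cube c r, st p ω x) ≠ 0 ∧ (∫⁻ x in cube c r, st p ω x) ≠ ⊤ := by
  obtain ⟨A, hA, hA0, h⟩ := ap_bound hp hω
  have h1 := h c r hr
  have h2 := ap_low hp hω c r hr
  have hp1 : 0 < p - 1 := by linarith
  have hp0 : 0 < p := by linarith
  have t0 : ENNReal.ofReal (r ^ n) ^ p ≠ 0 := by
    have : 0 < r ^ n := by positivity
    simp [this, hp0]
  have tt : ENNReal.ofReal (r ^ n) ^ p ≠ ⊤ := by simp [hp0.le]
  constructor
  · intro hV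
    rw [hV, ENNReal.zero_rpow_of_pos hp1, mul_zero] at h2
    exact t0 (le_antisymm h2 zero_le)
  · intro hV
    rw [hV, ENNReal.top_rpow_of_pos hp1] at h1 h2
    have : (∫⁻ x in cube c r, wt ω x) ≠ 0 := by
      intro hW; rw [hW, zero_mul] at h2; exact t0 (le_antisymm h2 zero_le)
    rw [ENNReal.mul_top this, top_le_iff] at h1
    exact ENNReal.mul_ne_top hA tt h1

lemma rev_doubling {n : ℕ} (hn : 0 < n) {p : ℝ} (hp : 1 < p) {ω : Rn n → ℝ} (hω : IsAp n p ω) :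
    ∃ ρ : ℝ≥0∞, ρ < 1 ∧ ∀ r : ℝ, 0 < r →
      (∫⁻ x in cube (0 : Rn n) r, st p ω x) ≤ ρ * ∫⁻ x in cube (0 : Rn n) (3 * r), st p ω x := by
  obtain ⟨A, hA, hA0, h⟩ := ap_bound hp hω
  have hp1 : 0 < p - 1 := by linarith
  have hp0 : 0 < p := by linarith
  set T : ℝ≥0∞ := ENNReal.ofReal (3 ^ n) ^ p with hT
  have T0 : T ≠ 0 := by simp [hT, hp0]
  have Tt : T ≠ ⊤ := by simp [hT, hp0.le]
  set C : ℝ≥0∞ := (A * T) ^ (1 / (p - 1)) with hC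
  have hAT0 : A * T ≠ 0 := mul_ne_zero hA0 T0
  have hATt : A * T ≠ ⊤ := ENNReal.mul_ne_top hA Tt
  have C0 : C ≠ 0 := by simp [hC, hAT0, hATt]
  have Ct : C ≠ ⊤ := by
    rw [hC]; exact ENNReal.rpow_ne_top_of_nonneg (by positivity) hATt
  refine ⟨1 - C⁻¹, ENNReal.sub_lt_self (by simp) (by simp) (by simpa using Ct), fun r hr => ?_⟩
  set c : Rn n := WithLp.toLp 2 (fun _ => r) with hc
  have hci : ∀ i, c i = r := fun i => rfl
  have hPQ : cube c r ⊆ cube 0 (3 * r) := by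
    intro x hx i
    have := hx i
    rw [hci, abs_lt] at this
    simp only [PiLp.zero_apply, sub_zero, abs_lt]
    constructor <;> linarith [this.1, this.2]
  have hQQ : cube (0 : Rn n) r ⊆ cube 0 (3 * r) := by
    intro x hx i
    have := hx i
    linarith
  have hdis : Disjoint (cube (0 : Rn n) r) (cube c r) := by
    rw [Set.disjoint_left]
    intro x hx hx'
    have h1 := hx ⟨0, hn⟩
    have h2 := hx' ⟨0, hn⟩
    rw [hci, abs_lt] at h2
    simp only [PiLp.zero_apply, sub_zero, abs_lt] at h1
    linarith [h1.2, h2.1]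
  have hV := (st_fin hp hω 0 (3 * r) (by positivity))
  have hsum : (∫⁻ x in cube (0 : Rn n) r, st p ω x) + (∫⁻ x in cube c r, st p ω x) ≤
      ∫⁻ x in cube (0 : Rn n) (3 * r), st p ω x := by
    rw [← lintegral_union (measurableSet_cube _ _) hdis]
    exact lintegral_mono_set (union_subset hQQ hPQ)
  have hW : (∫⁻ x in cube c r, wt ω x) ≤ ∫⁻ x in cube (0 : Rn n) (3 * r), wt ω x :=
    lintegral_mono_set hPQ
  have hlow := ap_low hp hω c r hr
  have hup := h 0 (3 * r) (by positivity)
  have et : ENNReal.ofReal ((3 * r) ^ n) ^ p = T * ENNReal.ofReal (r ^ n) ^ p := by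
    rw [mul_pow, ENNReal.ofReal_mul (by positivity), ENNReal.mul_rpow_of_nonneg _ _ hp0.le]
  rw [et] at hup
  have t0 : ENNReal.ofReal (r ^ n) ^ p ≠ 0 := by
    have : 0 < r ^ n := by positivity
    simp [this, hp0]
  have tt : ENNReal.ofReal (r ^ n) ^ p ≠ ⊤ := by simp [hp0.le]
  generalize ENNReal.ofReal (r ^ n) ^ p = t at *
  generalize (∫⁻ x in cube (0 : Rn n) r, st p ω x) = U at *
  generalize (∫⁻ x in cube (0 : Rn n) (3 * r), st p ω x) = V at *
  generalize (∫⁻ x in cube c r, st p ω x) = S at *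
  generalize (∫⁻ x in cube c r, wt ω x) = W1 at *
  generalize (∫⁻ x in cube (0 : Rn n) (3 * r), wt ω x) = W at *
  have k1 : t * V ^ (p - 1) ≤ t * (A * T * S ^ (p - 1)) := by
    calc t * V ^ (p - 1) ≤ W1 * S ^ (p - 1) * V ^ (p - 1) := by gcongr
      _ ≤ W * S ^ (p - 1) * V ^ (p - 1) := by gcongr
      _ = (W * V ^ (p - 1)) * S ^ (p - 1) := by ring
      _ ≤ (A * (T * t)) * S ^ (p - 1) := by gcongr
      _ = _ := by ring
  rw [ENNReal.mul_le_mul_iff_right t0 tt] at k1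
  have k2 : V ≤ C * S := by
    have := ENNReal.rpow_le_rpow k1 (z := 1 / (p - 1)) (by positivity)
    rwa [ENNReal.mul_rpow_of_nonneg _ _ (by positivity), ← ENNReal.rpow_mul, ← ENNReal.rpow_mul,
      mul_one_div_cancel hp1.ne', ENNReal.rpow_one, ENNReal.rpow_one] at this
  have k3 : C⁻¹ * V ≤ S := (ENNReal.inv_mul_le_iff C0 Ct).2 k2
  rw [ENNReal.sub_mul (fun _ _ => hV.2), one_mul]
  apply ENNReal.le_sub_of_add_le_right (ENNReal.mul_ne_top (by simpa using C0) hV.2)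
  exact (add_le_add_right k3 U).trans hsum

def hker {n : ℕ} (p : ℝ) (x : Rn n) : ℝ≥0∞ := ENNReal.ofReal ((‖x‖ ^ n)⁻¹) ^ p

lemma hker_meas {n : ℕ} (p : ℝ) : Measurable (hker (n := n) p) := by
  unfold hker
  fun_prop

lemma norm_of_mem_cube {n : ℕ} {x : Rn n} {r : ℝ} (h : x ∈ cube (0 : Rn n) r) :
    ‖x‖ ≤ n * (r / 2) := by
  rw [← (EuclideanSpace.basisFun (Fin n) ℝ).sum_repr x]
  refine (norm_sum_le _ _).trans ?_
  have : ∀ i ∈ Finset.univ, ‖(EuclideanSpace.basisFun (Fin n) ℝ).repr x i •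
      (EuclideanSpace.basisFun (Fin n) ℝ) i‖ ≤ r / 2 := by
    intro i _
    rw [norm_smul]
    have := (h i).le
    simpa using this
  refine (Finset.sum_le_sum this).trans ?_
  simp

lemma fin_tail {n : ℕ} (hn : 0 < n) {p : ℝ} (hp : 1 < p) {ω : Rn n → ℝ} (hω : IsAp n p ω) :
    ∫⁻ x in (cube (0 : Rn n) 1)ᶜ, wt ω x * hker p x ≠ ⊤ := by
  obtain ⟨A, hA, hA0, h⟩ := ap_bound hp hω
  obtain ⟨ρ, hρ, hrd⟩ := rev_doubling hn hp hω
  have hp1 : 0 < p - 1 := by linarith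
  have hp0 : 0 < p := by linarith
  set Q : ℕ → Set (Rn n) := fun k => cube 0 (3 ^ k) with hQ
  set V : ℕ → ℝ≥0∞ := fun k => ∫⁻ x in Q k, st p ω x with hV
  set W : ℕ → ℝ≥0∞ := fun k => ∫⁻ x in Q k, wt ω x with hW
  have hVf : V 0 ≠ 0 ∧ V 0 ≠ ⊤ := st_fin hp hω 0 (3 ^ 0) (by positivity)
  have hVs : ∀ k, V k ≤ ρ * V (k + 1) := by
    intro k
    have := hrd (3 ^ k) (by positivity)
    simp only [hV, hQ, pow_succ']
    exact this
  have hV0 : ∀ k, V 0 ≤ ρ ^ k * V k := by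
    intro k
    induction k with
    | zero => simp
    | succ k ih =>
      calc V 0 ≤ ρ ^ k * V k := ih
        _ ≤ ρ ^ k * (ρ * V (k + 1)) := by gcongr; exact hVs k
        _ = _ := by ring
  have hv : V 0 ^ (p - 1) ≠ 0 := by simp [hVf.1, hVf.2]
  have hvt : V 0 ^ (p - 1) ≠ ⊤ := ENNReal.rpow_ne_top_of_nonneg hp1.le hVf.2
  set τ : ℝ≥0∞ := ρ ^ (p - 1) with hτ
  have hτ1 : τ < 1 := ENNReal.rpow_lt_one hρ hp1
  have hWk : ∀ k, W k * V 0 ^ (p - 1) ≤ τ ^ k * (A * ENNReal.ofReal ((3 ^ k) ^ n) ^ p) := by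
    intro k
    calc W k * V 0 ^ (p - 1) ≤ W k * (ρ ^ k * V k) ^ (p - 1) := by gcongr; exact hV0 k
      _ = τ ^ k * (W k * V k ^ (p - 1)) := by
        rw [ENNReal.mul_rpow_of_nonneg _ _ hp1.le, hτ, ← ENNReal.rpow_natCast,
          ← ENNReal.rpow_natCast, ← ENNReal.rpow_mul, ← ENNReal.rpow_mul, mul_comm (k : ℝ)]
        ring
      _ ≤ _ := mul_le_mul_right (h 0 (3 ^ k) (by positivity)) _
  set B : ℝ≥0∞ := ENNReal.ofReal (6 ^ n) ^ p with hB
  have hBt : B ≠ ⊤ := by simp [hB, hp0.le]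
  have hSk : ∀ k, (∫⁻ x in Q (k + 1) \ Q k, wt ω x * hker p x) * V 0 ^ (p - 1) ≤
      A * B * τ ^ (k + 1) := by
    intro k
    have hb : ∀ x ∈ Q (k + 1) \ Q k,
        wt ω x * hker p x ≤ wt ω x * ENNReal.ofReal (((3 ^ k / 2) ^ n)⁻¹) ^ p := by
      intro x hx
      unfold hker
      gcongr
      have := hx.2
      simp only [hQ, cube, Set.mem_setOf_eq, not_forall, not_lt] at this
      obtain ⟨i, hi⟩ := this
      have h2 := PiLp.norm_apply_le x i
      simp only [PiLp.zero_apply, sub_zero] at hi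
      exact hi.trans h2
    have hmS : MeasurableSet (Q (k + 1) \ Q k) :=
      (measurableSet_cube _ _).diff (measurableSet_cube _ _)
    calc (∫⁻ x in Q (k + 1) \ Q k, wt ω x * hker p x) * V 0 ^ (p - 1)
        ≤ (∫⁻ x in Q (k + 1) \ Q k, wt ω x * ENNReal.ofReal (((3 ^ k / 2) ^ n)⁻¹) ^ p)
            * V 0 ^ (p - 1) := by
          gcongr 1
          exact setLIntegral_mono' hmS hb
      _ ≤ (∫⁻ x in Q (k + 1), wt ω x * ENNReal.ofReal (((3 ^ k / 2) ^ n)⁻¹) ^ p)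
            * V 0 ^ (p - 1) := by
          gcongr 1
          exact lintegral_mono_set diff_subset
      _ = ENNReal.ofReal (((3 ^ k / 2) ^ n)⁻¹) ^ p * (W (k + 1) * V 0 ^ (p - 1)) := by
          rw [lintegral_mul_const' _ _ (by simp [hp0.le])]
          ring
      _ ≤ ENNReal.ofReal (((3 ^ k / 2) ^ n)⁻¹) ^ p *
            (τ ^ (k + 1) * (A * ENNReal.ofReal ((3 ^ (k + 1)) ^ n) ^ p)) := by
          exact mul_le_mul_right (hWk (k + 1)) _
      _ = A * (ENNReal.ofReal (((3 ^ k / 2) ^ n)⁻¹) ^ p * ENNReal.ofReal ((3 ^ (k + 1)) ^ n) ^ p)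
            * τ ^ (k + 1) := by ring
      _ = _ := by
          rw [← ENNReal.mul_rpow_of_nonneg _ _ hp0.le, ← ENNReal.ofReal_mul (by positivity), hB]
          congr 5
          rw [← inv_pow, ← mul_pow]
          congr 1
          field_simp
          ring
  have hcov : (cube (0 : Rn n) 1)ᶜ ⊆ ⋃ k, Q (k + 1) \ Q k := by
    intro x hx
    have hex : ∃ k, x ∈ Q k := by
      obtain ⟨k, hk⟩ := pow_unbounded_of_one_lt (2 * ‖x‖) (by norm_num : (1 : ℝ) < 3)
      refine ⟨k, fun i => ?_⟩
      have := PiLp.norm_apply_le x i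
      rw [Real.norm_eq_abs] at this
      simp only [PiLp.zero_apply, sub_zero]
      linarith
    classical
    have hf := Nat.find_spec hex
    have h0 : Nat.find hex ≠ 0 := by
      intro h0
      rw [h0] at hf
      apply hx
      simpa [hQ] using hf
    obtain ⟨k, hk⟩ := Nat.exists_eq_succ_of_ne_zero h0
    rw [mem_iUnion]
    refine ⟨k, ?_, Nat.find_min hex (by omega)⟩
    rw [hk] at hf
    exact hf
  have hfin : (∫⁻ x in (cube (0 : Rn n) 1)ᶜ, wt ω x * hker p x) * V 0 ^ (p - 1) ≠ ⊤ := by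
    apply ne_top_of_le_ne_top (b := A * B * τ * (1 - τ)⁻¹)
    · refine ENNReal.mul_ne_top (ENNReal.mul_ne_top (ENNReal.mul_ne_top hA hBt)
        (hτ1.trans_le le_top).ne) ?_
      exact ENNReal.inv_ne_top.2 (tsub_pos_of_lt hτ1).ne'
    calc _ ≤ (∑' k, ∫⁻ x in Q (k + 1) \ Q k, wt ω x * hker p x) * V 0 ^ (p - 1) := by
          gcongr
          exact (lintegral_mono_set hcov).trans (lintegral_iUnion_le _ _)
      _ = ∑' k, (∫⁻ x in Q (k + 1) \ Q k, wt ω x * hker p x) * V 0 ^ (p - 1) := by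
          rw [ENNReal.tsum_mul_right]
      _ ≤ ∑' k, A * B * τ * τ ^ k := by
          refine ENNReal.tsum_le_tsum fun k => (hSk k).trans (le_of_eq ?_)
          ring
      _ = _ := by rw [ENNReal.tsum_mul_left, ENNReal.tsum_geometric]
  intro htop
  rw [htop, ENNReal.top_mul hv] at hfin
  exact hfin rfl

lemma meas_out {n : ℕ} (R : ℝ) : MeasurableSet {x : Rn n | R < ‖x‖} :=
  measurableSet_lt measurable_const measurable_norm

lemma tail_tendsto {n : ℕ} (hn : 0 < n) {p : ℝ} (hp : 1 < p) {ω : Rn n → ℝ} (hω : IsAp n p ω) :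
    Tendsto (fun R : ℝ => ∫⁻ x in {x : Rn n | R < ‖x‖}, hker p x ∂(wMeasure n ω))
      atTop (𝓝 0) := by
  have key := tendsto_lintegral_filter_of_dominated_convergence (μ := wMeasure n ω) (l := atTop)
    (F := fun (R : ℝ) (x : Rn n) => {x : Rn n | R < ‖x‖}.indicator (hker p) x) (f := fun _ => 0)
    ((cube (0 : Rn n) 1)ᶜ.indicator (hker p)) ?_ ?_ ?_ ?_
  · simp only [lintegral_zero] at key
    refine key.congr fun R => ?_
    rw [lintegral_indicator (meas_out R)]
  · exact Eventually.of_forall fun R => (hker_meas p).indicator (meas_out R)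
  · filter_upwards [eventually_ge_atTop ((n : ℝ) * (1 / 2))] with R hR
    refine Eventually.of_forall fun x => ?_
    apply indicator_le_indicator_of_subset _ (fun _ => zero_le)
    intro x hx hx'
    have := norm_of_mem_cube hx'
    have hx2 : R < ‖x‖ := hx
    linarith
  · rw [lintegral_indicator (measurableSet_cube _ _).compl]
    change ∫⁻ x in _, hker p x ∂((volume : Measure (Rn n)).withDensity (wt ω)) ≠ ⊤
    rw [restrict_withDensity (measurableSet_cube _ _).compl,
      lintegral_withDensity_eq_lintegral_mul₀ (wt_aem hω).restrict (hker_meas p).aemeasurable]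
    exact fin_tail hn hp hω
  · refine Eventually.of_forall fun x => ?_
    apply tendsto_const_nhds.congr'
    filter_upwards [eventually_ge_atTop ‖x‖] with R hR
    rw [indicator_of_notMem]
    simpa using hR

lemma pointwise_bound {n : ℕ} {p : ℝ} (hp : 1 < p) {ω : Rn n → ℝ} (hω : IsAp n p ω)
    {θ : ℝ → ℝ} {C₀ C₁ : ℝ} {K : Rn n → Rn n → ℝ} (hK : IsThetaKernel n θ C₀ K)
    {ψ : ℝ → ℝ} (hψ : PsiCond ψ C₁) {b : Rn n → ℝ} {M r : ℝ} (hM : ∀ x, |b x| ≤ M)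
    (hr : 0 < r) (hbr : ∀ x, r < ‖x‖ → b x = 0) (η : ℝ) (f : Rn n → ℝ)
    (hf : MemLp f (ENNReal.ofReal p) (wMeasure n ω) ∧
            eLpNorm f (ENNReal.ofReal p) (wMeasure n ω) ≤ 1) (x : Rn n) (hx : 2 * r < ‖x‖) :
    ENNReal.ofReal |∫ y, (b x - b y) * (K x y * ψ (‖x - y‖ / η)) * f y| ^ p ≤
      ENNReal.ofReal (M * |C₀| * 2 ^ n) ^ p *
        (∫⁻ y in cube (0 : Rn n) (2 * r + 2), st p ω y) ^ (p - 1) * hker p x := by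
  have hp0 : 0 < p := by linarith
  have hM0 : 0 ≤ M := (abs_nonneg _).trans (hM 0)
  have hac : (volume : Measure (Rn n)) ≪ wMeasure n ω := by
    apply withDensity_absolutelyContinuous' (wt_aem hω)
    filter_upwards [hω.1] with x hx
    simpa [wt] using hx
  have hfm : AEMeasurable (fun y => ‖f y‖ₑ) (volume : Measure (Rn n)) :=
    (hf.1.1.mono_ac hac).enorm
  have hnorm : ∫⁻ y, ‖f y‖ₑ ^ p * wt ω y ≤ 1 := by
    have h1 := hf.2
    rw [eLpNorm_eq_lintegral_rpow_enorm_toReal (by simpa using hp0) (by simp),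
      ENNReal.toReal_ofReal hp0.le] at h1
    have h2 := ENNReal.rpow_le_rpow h1 hp0.le
    rw [← ENNReal.rpow_mul, one_div_mul_cancel hp0.ne', ENNReal.rpow_one, ENNReal.one_rpow] at h2
    change ∫⁻ x, ‖f x‖ₑ ^ p ∂((volume : Measure (Rn n)).withDensity (wt ω)) ≤ 1 at h2
    rw [lintegral_withDensity_eq_lintegral_mul_non_measurable₀ _ (wt_aem hω)
      (Eventually.of_forall fun x => by simp [wt])] at h2
    refine le_trans (le_of_eq ?_) h2
    congr 1; ext y; simp [wt, mul_comm]
  have hfB : (∫⁻ y in cube (0 : Rn n) (2 * r + 2), ‖f y‖ₑ) ^ p ≤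
      (∫⁻ y in cube (0 : Rn n) (2 * r + 2), st p ω y) ^ (p - 1) := by
    refine (holder hp hω _ hfm _).trans ?_
    calc _ ≤ 1 * (∫⁻ y in cube (0 : Rn n) (2 * r + 2), st p ω y) ^ (p - 1) := by
          gcongr
          exact (setLIntegral_le_lintegral _ _).trans hnorm
      _ = _ := one_mul _
  set D := M * |C₀| * 2 ^ n with hD
  have hD0 : 0 ≤ D := by positivity
  have hpt : ∀ y, ‖(b x - b y) * (K x y * ψ (‖x - y‖ / η)) * f y‖ₑ ≤
      (cube (0 : Rn n) (2 * r + 2)).indicator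
        (fun y => ENNReal.ofReal (D * (‖x‖ ^ n)⁻¹) * ‖f y‖ₑ) y := by
    intro y
    have hbx : b x = 0 := hbr x (by linarith)
    by_cases hy : r < ‖y‖
    · simp [hbx, hbr y hy]
    push Not at hy
    have hyc : y ∈ cube (0 : Rn n) (2 * r + 2) := by
      intro i
      have := PiLp.norm_apply_le y i
      rw [Real.norm_eq_abs] at this
      simp only [PiLp.zero_apply, sub_zero]
      linarith
    rw [indicator_of_mem hyc, enorm_mul]
    gcongr
    rw [← ofReal_norm_eq_enorm]
    apply ENNReal.ofReal_le_ofReal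
    have hxy : ‖x‖ / 2 ≤ ‖x - y‖ := by
      have := norm_sub_norm_le x y
      linarith
    have hx0 : 0 < ‖x‖ := by linarith
    have hne : x ≠ y := by
      rintro rfl
      linarith
    have hK1 : |K x y| ≤ |C₀| * 2 ^ n * (‖x‖ ^ n)⁻¹ := by
      calc |K x y| ≤ C₀ / ‖x - y‖ ^ n := hK.1 x y hne
        _ ≤ |C₀| / (‖x‖ / 2) ^ n := by
          gcongr
          exact le_abs_self _
        _ = _ := by rw [div_pow]; field_simp
    have hψ1 : |ψ (‖x - y‖ / η)| ≤ 1 := by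
      rw [abs_of_nonneg (hψ.1 _).1]; exact (hψ.1 _).2
    rw [Real.norm_eq_abs, hbx, zero_sub, abs_mul, abs_mul, abs_neg]
    calc |b y| * (|K x y| * |ψ (‖x - y‖ / η)|)
        ≤ M * ((|C₀| * 2 ^ n * (‖x‖ ^ n)⁻¹) * 1) := by
          gcongr
          exact hM y
      _ = _ := by rw [hD]; ring
  have hint : ENNReal.ofReal |∫ y, (b x - b y) * (K x y * ψ (‖x - y‖ / η)) * f y| ≤
      ENNReal.ofReal (D * (‖x‖ ^ n)⁻¹) * ∫⁻ y in cube (0 : Rn n) (2 * r + 2), ‖f y‖ₑ := by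
    rw [← Real.norm_eq_abs, ofReal_norm_eq_enorm]
    refine (enorm_integral_le_lintegral_enorm _).trans ?_
    refine (lintegral_mono hpt).trans ?_
    rw [lintegral_indicator (measurableSet_cube _ _), lintegral_const_mul' _ _ (by simp)]
  calc _ ≤ (ENNReal.ofReal (D * (‖x‖ ^ n)⁻¹) *
        ∫⁻ y in cube (0 : Rn n) (2 * r + 2), ‖f y‖ₑ) ^ p := by gcongr
    _ = ENNReal.ofReal D ^ p * (∫⁻ y in cube (0 : Rn n) (2 * r + 2), ‖f y‖ₑ) ^ p * hker p x := by
      rw [ENNReal.mul_rpow_of_nonneg _ _ hp0.le, ENNReal.ofReal_mul hD0,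
        ENNReal.mul_rpow_of_nonneg _ _ hp0.le, hker]
      ring
    _ ≤ _ := by gcongr

/-- For `1 < p < ∞`, `ω ∈ A_p`, `K` a θ-type kernel, `b ∈ C_c^∞(ℝⁿ)` and
fixed `η > 0`, the family `{[b,T^η]f : ‖f‖_{L^p(ω)} ≤ 1}` uniformly vanishes at infinity:
`sup_{‖f‖≤1} (∫_{|x|>R} |[b,T^η]f(x)|^p ω(x) dx)^{1/p} → 0` as `R → ∞`. -/
theorem statement6 {n : ℕ} (p : ℝ) (hp : 1 < p)
    (ω : Rn n → ℝ) (hω : IsAp n p ω)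
    (θ : ℝ → ℝ) (hθ : IsModulus θ)
    (C₀ C₁ : ℝ) (K : Rn n → Rn n → ℝ) (hK : IsThetaKernel n θ C₀ K)
    (ψ : ℝ → ℝ) (hψ : PsiCond ψ C₁)
    (b : Rn n → ℝ) (hb1 : ContDiff ℝ (⊤ : ℕ∞) b) (hb2 : HasCompactSupport b)
    (η : ℝ) (hη : 0 < η) :
    Tendsto (fun R : ℝ =>
        ⨆ (f : Rn n → ℝ) (_ : MemLp f (ENNReal.ofReal p) (wMeasure n ω) ∧
            eLpNorm f (ENNReal.ofReal p) (wMeasure n ω) ≤ 1),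
          (∫⁻ x in {x : Rn n | R < ‖x‖},
              ENNReal.ofReal |∫ y, (b x - b y) * (K x y * ψ (‖x - y‖ / η)) * f y| ^ p
            ∂(wMeasure n ω)) ^ (1 / p))
      atTop (𝓝 0) := by
  have hp0 : 0 < p := by linarith
  rcases Nat.eq_zero_or_pos n with hn | hn
  · subst hn
    apply tendsto_const_nhds.congr'
    filter_upwards [eventually_ge_atTop (0 : ℝ)] with R hR
    have he : {x : Rn 0 | R < ‖x‖} = ∅ := by
      ext x
      have : x = 0 := Subsingleton.elim _ _
      simp [this, hR]
    rw [he]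
    simp [hp0]
  obtain ⟨M, hM⟩ := hb2.exists_bound_of_continuous hb1.continuous
  obtain ⟨r, hr, hbr⟩ : ∃ r : ℝ, 0 < r ∧ ∀ x, r < ‖x‖ → b x = 0 := by
    obtain ⟨r, hr⟩ := hb2.isCompact.isBounded.subset_closedBall 0
    refine ⟨max r 1, by positivity, fun x hx => ?_⟩
    by_contra hne
    have := hr (subset_tsupport b hne)
    rw [mem_closedBall_zero_iff] at this
    exact absurd (this.trans (le_max_left r 1)) (not_le.2 hx)
  set Z : ℝ≥0∞ := ENNReal.ofReal (M * |C₀| * 2 ^ n) ^ p *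
        (∫⁻ y in cube (0 : Rn n) (2 * r + 2), st p ω y) ^ (p - 1) with hZ
  have hZt : Z ≠ ⊤ := ENNReal.mul_ne_top (by simp [hp0.le])
    (ENNReal.rpow_ne_top_of_nonneg (by linarith) (st_fin hp hω 0 (2 * r + 2) (by positivity)).2)
  have hlim : Tendsto (fun R : ℝ =>
      (Z * ∫⁻ x in {x : Rn n | R < ‖x‖}, hker p x ∂(wMeasure n ω)) ^ (1 / p)) atTop (𝓝 0) := by
    have h1 := ENNReal.Tendsto.const_mul (tail_tendsto hn hp hω) (Or.inr hZt)
    have h2 := h1.ennrpow_const (1 / p)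
    rwa [mul_zero, ENNReal.zero_rpow_of_pos (by positivity)] at h2
  refine tendsto_of_tendsto_of_tendsto_of_le_of_le' tendsto_const_nhds hlim
    (Eventually.of_forall fun _ => zero_le) ?_
  filter_upwards [eventually_ge_atTop (2 * r)] with R hR
  refine iSup₂_le fun f hf => ?_
  apply ENNReal.rpow_le_rpow _ (by positivity)
  rw [← lintegral_const_mul' _ _ hZt]
  refine setLIntegral_mono' (meas_out R) fun x hx => ?_
  exact pointwise_bound hp hω hK hψ (fun x => hM x) hr hbr η f hf x (lt_of_le_of_lt hR hx)
end
end

section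
/- Let K be a θ-type kernel on ℝⁿ and b ∈ L^∞(ℝⁿ). There is a constant C=C(n) such that for every η>0, every h ∈ ℝⁿ with |h| < η/4, every locally integrable f and every x: |∫_{ℝⁿ} (b(x+h)−b(y)) (K(x,y)−K(x+h,y)) ψ(|x−y|/η) f(y) dy| ≤ C ‖b‖_∞ Mf(x) ∫₀^{4|h|/η} θ(t)/t dt. -/
open MeasureTheory Metric Filter Set
open scoped ENNReal Topology

noncomputable section

lemma aux_theta (θ : ℝ → ℝ) (hθ : IsModulus θ) (hD : DiniCondition θ) (u : ℝ) (hu : 0 < u)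
    (hu1 : u ≤ 1) :
    ∑' k : ℕ, ENNReal.ofReal (θ (u * (1/2)^(k+1))) ≤
      2 * ENNReal.ofReal (∫ t in Ioc (0:ℝ) u, θ t / t) := by
  obtain ⟨hc, hm, -, h0, hnn⟩ := hθ
  have hint : IntegrableOn (fun t => θ t / t) (Ioc (0:ℝ) u) :=
    hD.mono_set (Ioc_subset_Ioc_right hu1)
  rw [ofReal_integral_eq_lintegral_ofReal hint]
  swap
  · refine (ae_restrict_iff' measurableSet_Ioc).2 (Eventually.of_forall fun t ht => ?_)
    exact div_nonneg (hnn t ⟨ht.1.le, ht.2.trans hu1⟩) ht.1.le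
  set a : ℕ → ℝ := fun k => u * (1/2)^k with ha
  have hanti : Antitone a := by
    intro i j hij
    simp only [ha]
    have : ((1:ℝ)/2)^j ≤ (1/2)^i := pow_le_pow_of_le_one (by norm_num) (by norm_num) hij
    gcongr
  have hapos : ∀ k, 0 < a k := fun k => by simp only [ha]; positivity
  have hale : ∀ k, a k ≤ u := fun k => by simpa [ha] using hanti (Nat.zero_le k)
  have hterm : ∀ k : ℕ, ENNReal.ofReal (θ (a (k+1))) ≤
      2 * ∫⁻ t in Ioc (a (k+1)) (a k), ENNReal.ofReal (θ t / t) := by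
    intro k
    have hs : a (k+1) = a k / 2 := by simp only [ha]; ring
    have h1 : ENNReal.ofReal (θ (a (k+1)) / a k) * volume (Ioc (a (k+1)) (a k)) ≤
        ∫⁻ t in Ioc (a (k+1)) (a k), ENNReal.ofReal (θ t / t) := by
      rw [← setLIntegral_const]
      refine setLIntegral_mono' measurableSet_Ioc fun t ht => ENNReal.ofReal_le_ofReal ?_
      have htp : 0 < t := (hapos _).trans ht.1
      have hA : a (k+1) ∈ Icc (0:ℝ) 1 := ⟨(hapos _).le, (hale _).trans hu1⟩
      have hT : t ∈ Icc (0:ℝ) 1 := ⟨htp.le, ht.2.trans ((hale _).trans hu1)⟩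
      exact div_le_div₀ (hnn t hT) (hm hA hT ht.1.le) htp ht.2
    refine le_trans ?_ (mul_le_mul_right h1 2)
    rw [Real.volume_Ioc, ← ENNReal.ofReal_mul' (by linarith [hapos k]),
      show (2:ℝ≥0∞) = ENNReal.ofReal 2 by simp, ← ENNReal.ofReal_mul (by norm_num)]
    refine ENNReal.ofReal_le_ofReal (le_of_eq ?_)
    have := (hapos k).ne'
    rw [show a k - a (k+1) = a k / 2 by rw [hs]; ring]
    field_simp
  calc ∑' k : ℕ, ENNReal.ofReal (θ (a (k+1)))
      ≤ ∑' k : ℕ, 2 * ∫⁻ t in Ioc (a (k+1)) (a k), ENNReal.ofReal (θ t / t) :=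
        ENNReal.tsum_le_tsum hterm
    _ = 2 * ∫⁻ t in ⋃ k, Ioc (a (k+1)) (a k), ENNReal.ofReal (θ t / t) := by
        rw [ENNReal.tsum_mul_left, lintegral_iUnion (fun _ => measurableSet_Ioc)]
        exact hanti.pairwise_disjoint_on_Ioc_succ
    _ ≤ _ := by
        refine mul_le_mul_right (lintegral_mono_set ?_) 2
        exact iUnion_subset fun k => Ioc_subset_Ioc (hapos _).le (hale _)

lemma aux_max {n : ℕ} (f : Rn n → ℝ) (x : Rn n) (r : ℝ) (hr : 0 < r) :
    ∫⁻ y in ball x r, ENNReal.ofReal |f y| ≤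
      ENNReal.ofReal (r ^ n) * volume (ball (0 : Rn n) 1) * maximal f x := by
  have hv : volume (ball x r) = ENNReal.ofReal (r ^ n) * volume (ball (0 : Rn n) 1) := by
    rw [Measure.addHaar_ball_of_pos _ _ hr]; simp
  rw [← hv]
  have h1 : (volume (ball x r))⁻¹ * ∫⁻ y in ball x r, ENNReal.ofReal |f y| ≤ maximal f x :=
    le_iSup₂ (f := fun (r : ℝ) (_ : 0 < r) =>
      (volume (ball x r))⁻¹ * ∫⁻ y in ball x r, ENNReal.ofReal |f y|) r hr
  refine le_trans (le_of_eq ?_) (mul_le_mul_right h1 _)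
  rw [← mul_assoc, ENNReal.mul_inv_cancel (measure_ball_pos _ _ hr).ne' measure_ball_lt_top.ne,
    one_mul]

lemma aux_pt {n : ℕ} (θ : ℝ → ℝ) (hθ : IsModulus θ) (C₀ C₁ : ℝ) (ψ : ℝ → ℝ)
    (hψ : PsiCond ψ C₁) (K : Rn n → Rn n → ℝ) (hK : IsThetaKernel n θ C₀ K)
    (b : Rn n → ℝ) (B : ℝ) (hb : ∀ y, |b y| ≤ B) (η : ℝ) (hη : 0 < η) (h : Rn n)
    (hh : ‖h‖ < η / 4) (f : Rn n → ℝ) (x y : Rn n) :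
    ENNReal.ofReal |(b (x + h) - b y) * (K x y - K (x + h) y) * ψ (‖x - y‖ / η) * f y| ≤
      ∑' k : ℕ, ENNReal.ofReal (2 * B * θ (4 * ‖h‖ / η * (1/2)^(k+1)) / (η / 2 * 2^k)^n) *
        (ball x (η / 2 * 2^(k+1))).indicator (fun y => ENNReal.ofReal |f y|) y := by
  obtain ⟨hψ1, hψ2, -, -⟩ := hψ
  have hB : 0 ≤ B := (abs_nonneg _).trans (hb 0)
  rcases lt_or_ge (‖x - y‖) (η / 2) with hd | hd
  · rw [hψ2 (‖x - y‖ / η) (by rw [div_le_iff₀ hη]; linarith)]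
    simp
  · obtain ⟨k, hk1, hk2⟩ := exists_nat_pow_near (x := ‖x - y‖ / (η / 2)) (y := 2)
      ((one_le_div (by positivity)).2 hd) (by norm_num)
    rw [le_div_iff₀ (by positivity)] at hk1
    rw [div_lt_iff₀ (by positivity)] at hk2
    refine le_trans ?_ (ENNReal.le_tsum k)
    have hy : y ∈ ball x (η / 2 * 2^(k+1)) := by
      rw [mem_ball, dist_comm, dist_eq_norm]; linarith
    rw [indicator_of_mem hy, ← ENNReal.ofReal_mul' (abs_nonneg _)]
    refine ENNReal.ofReal_le_ofReal ?_
    rw [abs_mul, abs_mul, abs_mul]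
    have hr : 0 < η / 2 * 2^k := by positivity
    have hdp : 0 < ‖x - y‖ := by linarith
    have hne : x ≠ y := by rintro rfl; simp at hdp
    have h1 : |b (x+h) - b y| ≤ 2 * B := by
      have := abs_sub (b (x+h)) (b y)
      linarith [hb (x+h), hb y]
    have hxh : ‖x - (x + h)‖ = ‖h‖ := by simp
    have h2 := hK.2 x (x+h) y hne (by rw [hxh]; linarith)
    rw [hxh] at h2
    have heq : 4 * ‖h‖ / η * (1/2)^(k+1) = ‖h‖ / (η / 2 * 2^k) := by
      rw [pow_succ, one_div_pow]; field_simp; ring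
    have hle : ‖h‖ / ‖x - y‖ ≤ ‖h‖ / (η / 2 * 2^k) := by
      gcongr; linarith
    have hk0 : (1:ℝ) ≤ 2^k := one_le_pow₀ (by norm_num)
    have h1' : ‖h‖ / (η / 2 * 2^k) ≤ 1 := by
      rw [div_le_one hr]; nlinarith
    have hmem : ‖h‖ / (η / 2 * 2^k) ∈ Icc (0:ℝ) 1 := ⟨by positivity, h1'⟩
    have h3 : |K x y - K (x+h) y| ≤ θ (‖h‖ / (η / 2 * 2^k)) / (η / 2 * 2^k)^n := by
      have h4 : θ (‖h‖ / ‖x - y‖) / ‖x - y‖ ^ n ≤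
          θ (‖h‖ / (η / 2 * 2^k)) / (η / 2 * 2^k)^n := by
        refine div_le_div₀ (hθ.2.2.2.2 _ hmem) (hθ.2.1 ⟨by positivity, hle.trans h1'⟩ hmem hle)
          (by positivity) ?_
        exact pow_le_pow_left₀ hr.le (by linarith) n
      linarith [abs_nonneg (K y x - K y (x+h))]
    have h5 : |ψ (‖x - y‖ / η)| ≤ 1 := by
      rw [abs_of_nonneg (hψ1 _).1]; exact (hψ1 _).2
    rw [heq]
    refine mul_le_mul_of_nonneg_right ?_ (abs_nonneg _)
    rw [mul_div_assoc]
    calc _ ≤ 2 * B * (θ (‖h‖ / (η / 2 * 2^k)) / (η / 2 * 2^k)^n) * 1 := by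
          have := (abs_nonneg _).trans h3
          exact mul_le_mul (mul_le_mul h1 h3 (abs_nonneg _) (by positivity)) h5 (abs_nonneg _)
            (by positivity)
      _ = _ := mul_one _

/-- If `K` is a θ-type kernel and `b ∈ L^∞(ℝⁿ)` (with pointwise bound `B`),
then there is `C = C(n)` such that for every `η > 0`, every `h` with `|h| < η/4`, every
locally integrable `f` and every `x`:
`|∫ (b(x+h)−b(y))(K(x,y)−K(x+h,y)) ψ(|x−y|/η) f(y) dy| ≤ C B Mf(x) ∫₀^{4|h|/η} θ(t)/t dt`. -/
theorem statement8 (n : ℕ) :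
    ∃ C : ℝ, 0 < C ∧
      ∀ θ : ℝ → ℝ, IsModulus θ → DiniCondition θ →
      ∀ C₀ C₁ : ℝ, ∀ ψ : ℝ → ℝ, PsiCond ψ C₁ →
      ∀ K : Rn n → Rn n → ℝ, IsThetaKernel n θ C₀ K →
      ∀ (b : Rn n → ℝ) (B : ℝ), (∀ y, |b y| ≤ B) →
      ∀ η : ℝ, 0 < η → ∀ h : Rn n, ‖h‖ < η / 4 →
      ∀ f : Rn n → ℝ, LocallyIntegrable f volume →
      ∀ x : Rn n,
        ENNReal.ofReal
            |∫ y, (b (x + h) - b y) * (K x y - K (x + h) y) * ψ (‖x - y‖ / η) * f y| ≤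
          ENNReal.ofReal (C * B * ∫ t in Ioc (0:ℝ) (4 * ‖h‖ / η), θ t / t) *
            maximal f x := by
  set V : ℝ≥0∞ := volume (ball (0 : Rn n) 1) with hV
  have hV0 : V ≠ 0 := (measure_ball_pos _ _ one_pos).ne'
  have hVt : V ≠ ⊤ := measure_ball_lt_top.ne
  have hVp : 0 < V.toReal := ENNReal.toReal_pos hV0 hVt
  refine ⟨4 * 2^n * V.toReal, by positivity, ?_⟩
  intro θ hθ hD C₀ C₁ ψ hψ K hK b B hb η hη h hh f hf x
  have hB : 0 ≤ B := (abs_nonneg _).trans (hb 0)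
  rcases eq_or_ne h 0 with rfl | hne
  · simp
  have hhp : 0 < ‖h‖ := norm_pos_iff.2 hne
  set u := 4 * ‖h‖ / η with hu
  have hup : 0 < u := by positivity
  have hu1 : u ≤ 1 := by rw [hu, div_le_one hη]; linarith
  have hT := aux_theta θ hθ hD u hup hu1
  set I := ∫ t in Ioc (0:ℝ) u, θ t / t with hI
  have hfm : AEMeasurable (fun y => ENNReal.ofReal |f y|) volume :=
    (hf.aestronglyMeasurable.aemeasurable.norm).ennreal_ofReal
  have hθn : ∀ k : ℕ, 0 ≤ θ (u * (1/2)^(k+1)) := fun k => by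
    refine hθ.2.2.2.2 _ ⟨by positivity, ?_⟩
    exact mul_le_one₀ hu1 (by positivity) (pow_le_one₀ (by norm_num) (by norm_num))
  have hterm : ∀ k : ℕ, ∫⁻ y, ENNReal.ofReal (2 * B * θ (u * (1/2)^(k+1)) / (η / 2 * 2^k)^n) *
        (ball x (η / 2 * 2^(k+1))).indicator (fun y => ENNReal.ofReal |f y|) y ≤
      ENNReal.ofReal (2 * B * 2^n) * V * maximal f x * ENNReal.ofReal (θ (u * (1/2)^(k+1))) := by
    intro k
    have hr : 0 < η / 2 * 2^k := by positivity
    rw [lintegral_const_mul' _ _ ENNReal.ofReal_ne_top, lintegral_indicator measurableSet_ball]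
    refine (mul_le_mul_right (aux_max f x _ (by positivity)) _).trans (le_of_eq ?_)
    rw [← mul_assoc, ← mul_assoc, ← ENNReal.ofReal_mul (by have := hθn k; positivity), ← hV]
    have : 2 * B * θ (u * (1/2)^(k+1)) / (η / 2 * 2^k)^n * (η / 2 * 2^(k+1))^n
        = 2 * B * 2^n * θ (u * (1/2)^(k+1)) := by
      rw [show η / 2 * 2^(k+1) = (η / 2 * 2^k) * 2 by ring, mul_pow _ (2:ℝ) n]
      field_simp
    rw [this, ENNReal.ofReal_mul (by positivity)]
    ring
  calc ENNReal.ofReal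
            |∫ y, (b (x + h) - b y) * (K x y - K (x + h) y) * ψ (‖x - y‖ / η) * f y|
      ≤ ∫⁻ y, ENNReal.ofReal
            |(b (x + h) - b y) * (K x y - K (x + h) y) * ψ (‖x - y‖ / η) * f y| := by
        have := enorm_integral_le_lintegral_enorm (μ := volume)
          (fun y => (b (x + h) - b y) * (K x y - K (x + h) y) * ψ (‖x - y‖ / η) * f y)
        simpa only [Real.enorm_eq_ofReal_abs] using this
    _ ≤ ∫⁻ y, ∑' k : ℕ, ENNReal.ofReal (2 * B * θ (u * (1/2)^(k+1)) / (η / 2 * 2^k)^n) *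
        (ball x (η / 2 * 2^(k+1))).indicator (fun y => ENNReal.ofReal |f y|) y :=
        lintegral_mono fun y => aux_pt θ hθ C₀ C₁ ψ hψ K hK b B hb η hη h hh f x y
    _ = ∑' k : ℕ, ∫⁻ y, ENNReal.ofReal (2 * B * θ (u * (1/2)^(k+1)) / (η / 2 * 2^k)^n) *
        (ball x (η / 2 * 2^(k+1))).indicator (fun y => ENNReal.ofReal |f y|) y :=
        lintegral_tsum fun k => (hfm.indicator measurableSet_ball).const_mul _
    _ ≤ ∑' k : ℕ, ENNReal.ofReal (2 * B * 2^n) * V * maximal f x *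
          ENNReal.ofReal (θ (u * (1/2)^(k+1))) := ENNReal.tsum_le_tsum hterm
    _ ≤ ENNReal.ofReal (2 * B * 2^n) * V * maximal f x * (2 * ENNReal.ofReal I) := by
        rw [ENNReal.tsum_mul_left]
        exact mul_le_mul_right hT _
    _ = ENNReal.ofReal (4 * 2^n * V.toReal * B * I) * maximal f x := by
        rw [show 4 * 2^n * V.toReal * B * I = (2 * B * 2^n) * V.toReal * 2 * I by ring,
          ENNReal.ofReal_mul (p := 2 * B * 2^n * V.toReal * 2) (by positivity),
          ENNReal.ofReal_mul (p := 2 * B * 2^n * V.toReal) (by positivity),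
          ENNReal.ofReal_mul (p := 2 * B * 2^n) (by positivity),
          ENNReal.ofReal_toReal hVt, ENNReal.ofReal_ofNat]
        ring
end
end
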